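/- arXiv:2405.03735 — 2 statements merged into one kernel-verified Lean document; each statement's English description precedes it below -/
import Mathlib

section
/- Let G = (N, v) be a characteristic function game with |N| = n ≥ 2. Then for every agent i ∈ N, the Exchange Value is a linear transformation of the Shapley Value: EV_i(G) = (n/(n−1)) · (SV_i(G) − v(N)/n). -/
open Finset

/-- The set of all permutations (encoded as lists) of the elements of a finset `s`.
For a nodup base list this is exactly the set `Π_s` of orderings of `s`. -/
noncomputable def permsOf {α : Type*} [DecidableEq α] (s : Finset α) : Finset (List α) :=
  s.toList.permutations.toFinset

/-- The Shapley Value of agent `i` in the characteristic function game on the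
(full, finite) agent set `α` with characteristic function `v`:
`SV_i = (1/n!) ∑_{m=0}^{n-1} ∑_{π ∈ Π_{N∖{i}}} (v (S_π(m) ∪ {i}) - v (S_π(m)))`,
where `S_π(m)` is the set of the first `m` entries of `π`. -/
noncomputable def ShapleyValue {α : Type*} [Fintype α] [DecidableEq α]
    (v : Finset α → ℝ) (i : α) : ℝ :=
  (((Fintype.card α).factorial : ℝ))⁻¹ *
    ∑ π ∈ permsOf (Finset.univ.erase i), ∑ m ∈ Finset.range (Fintype.card α),
      (v (insert i (π.take m).toFinset) - v (π.take m).toFinset)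

/-- The Exchange Value of agent `i`:
`EV_i = (1/((n-1)!·(n-1))) ∑_{m=1}^{n-1} ∑_{π ∈ Π_{N∖{i}}} (v (S_π(m-1) ∪ {i}) - v (S_π(m)))`. -/
noncomputable def ExchangeValue {α : Type*} [Fintype α] [DecidableEq α]
    (v : Finset α → ℝ) (i : α) : ℝ :=
  ((((Fintype.card α - 1).factorial * (Fintype.card α - 1) : ℕ) : ℝ))⁻¹ *
    ∑ π ∈ permsOf (Finset.univ.erase i), ∑ m ∈ Finset.Icc 1 (Fintype.card α - 1),
      (v (insert i (π.take (m - 1)).toFinset) - v (π.take m).toFinset)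

theorem card_permsOf {α : Type*} [DecidableEq α] (s : Finset α) :
    #(permsOf s) = (#s).factorial := by
  rw [permsOf, List.toFinset_card_of_nodup (List.nodup_permutations _ s.nodup_toList),
    List.length_permutations, length_toList]

theorem mem_permsOf {α : Type*} [DecidableEq α] {s : Finset α} {π : List α} :
    π ∈ permsOf s ↔ π.Perm s.toList := by
  simp [permsOf]

theorem toFinset_of_mem_permsOf {α : Type*} [DecidableEq α] {s : Finset α} {π : List α}
    (h : π ∈ permsOf s) : π.toFinset = s := by
  rw [List.toFinset_eq_of_perm _ _ (mem_permsOf.1 h), toList_toFinset]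

theorem length_of_mem_permsOf {α : Type*} [DecidableEq α] {s : Finset α} {π : List α}
    (h : π ∈ permsOf s) : π.length = #s := by
  rw [(mem_permsOf.1 h).length_eq, length_toList]

/-- Shifting the index of the first term turns a sum of marginal differences into a sum of
exchange differences, up to the two boundary terms. -/
theorem sum_Icc_shift_sub (f g : ℕ → ℝ) (k : ℕ) :
    ∑ m ∈ Icc 1 k, (f (m - 1) - g m) =
      ∑ m ∈ range (k + 1), (f m - g m) - f k + g 0 := by
  induction k with
  | zero => simp
  | succ k ih =>
    rw [sum_Icc_succ_top (by omega), ih, sum_range_succ _ (k + 1), Nat.add_sub_cancel]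
    ring

/-- Along one permutation, the exchange contributions of `i` sum to the marginal contributions
minus the value of the grand coalition. -/
theorem sum_exchange_eq_sum_marginal_sub {α : Type*} [Fintype α] [DecidableEq α]
    (v : Finset α → ℝ) (hv : v ∅ = 0) (i : α) {π : List α}
    (hπ : π ∈ permsOf (univ.erase i)) :
    ∑ m ∈ Icc 1 (Fintype.card α - 1),
        (v (insert i (π.take (m - 1)).toFinset) - v (π.take m).toFinset) =
      ∑ m ∈ range (Fintype.card α),
        (v (insert i (π.take m).toFinset) - v (π.take m).toFinset) - v univ := by
  have hlen : π.length = Fintype.card α - 1 := by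
    rw [length_of_mem_permsOf hπ, card_erase_of_mem (mem_univ i), card_univ]
  have htop : insert i (π.take (Fintype.card α - 1)).toFinset = univ := by
    rw [← hlen, List.take_length, toFinset_of_mem_permsOf hπ, insert_erase (mem_univ i)]
  have hcard : Fintype.card α - 1 + 1 = Fintype.card α :=
    Nat.sub_add_cancel (Fintype.card_pos_iff.2 ⟨i⟩)
  rw [sum_Icc_shift_sub (fun m => v (insert i (π.take m).toFinset))
    (fun m => v (π.take m).toFinset), hcard]
  simp [htop, hv]

/-- The Exchange Value is a linear transformation of the Shapley Value:
`EV_i(G) = (n/(n−1)) · (SV_i(G) − v(N)/n)` for `n ≥ 2`. -/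
theorem exchangeValue_eq_linear_transform_shapleyValue
    {α : Type*} [Fintype α] [DecidableEq α]
    (hn : 2 ≤ Fintype.card α) (v : Finset α → ℝ) (hv : v ∅ = 0) (i : α) :
    ExchangeValue v i =
      ((Fintype.card α : ℝ) / ((Fintype.card α : ℝ) - 1)) *
        (ShapleyValue v i - v Finset.univ / (Fintype.card α : ℝ)) := by
  rw [ExchangeValue, ShapleyValue,
    sum_congr rfl fun π hπ => sum_exchange_eq_sum_marginal_sub v hv i hπ,
    sum_sub_distrib, sum_const, card_permsOf, card_erase_of_mem (mem_univ i), card_univ,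
    nsmul_eq_mul]
  generalize ∑ π ∈ permsOf (univ.erase i), ∑ m ∈ range (Fintype.card α),
    (v (insert i (π.take m).toFinset) - v (π.take m).toFinset) = T
  obtain ⟨k, hk⟩ : ∃ k, Fintype.card α = k + 2 := ⟨_, (Nat.sub_add_cancel hn).symm⟩
  rw [hk, show k + 2 - 1 = k + 1 from rfl, Nat.factorial_succ (k + 1)]
  have hfact : ((k + 1).factorial : ℝ) ≠ 0 := by positivity
  have hsub : ((k + 2 : ℕ) : ℝ) - 1 = k + 1 := by push_cast; ring
  rw [hsub]
  push_cast
  field_simp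
  ring
end

section
/- For every characteristic function game G = (N, v) with |N| = n ≥ 2, the Exchange Values of all agents sum to zero: Σ_{i ∈ N} EV_i(G) = 0. -/
open Finset

theorem mem_permsOf_erase_iff {α : Type*} [Fintype α] [DecidableEq α] {i : α} {l : List α} :
    l ∈ permsOf (univ.erase i) ↔ (i :: l).Perm (univ : Finset α).toList := by
  have h : (univ : Finset α).toList.Perm (i :: (univ.erase i).toList) := by
    have := Finset.toList_insert (notMem_erase i (univ : Finset α))
    rwa [Finset.insert_erase (mem_univ i)] at this
  rw [permsOf, List.mem_toFinset, List.mem_permutations, ← List.perm_cons i]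
  exact ⟨fun hl => hl.trans h.symm, fun hl => hl.trans h⟩

theorem length_add_one_of_mem_permsOf_erase {α : Type*} [Fintype α] [DecidableEq α] {i : α}
    {l : List α} (hl : l ∈ permsOf (univ.erase i)) : l.length + 1 = Fintype.card α := by
  simpa using (mem_permsOf_erase_iff.1 hl).length_eq

theorem List.getElem_cons_set_perm {α : Type*} {l : List α} {k : ℕ} (hk : k < l.length) (i : α) :
    (l[k] :: l.set k i).Perm (i :: l) :=
  ((List.set_perm_cons_eraseIdx hk i).cons _).trans <| (List.Perm.swap _ _ _).trans <|
    (List.getElem_cons_eraseIdx_perm hk).cons _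

theorem List.toFinset_take_succ_set {α : Type*} [DecidableEq α] {l : List α} {k : ℕ}
    (hk : k < l.length) (i : α) :
    ((l.set k i).take (k + 1)).toFinset = insert i (l.take k).toFinset := by
  rw [List.take_succ_eq_append_getElem (by simpa using hk)]
  ext x
  simp [List.take_set_of_le]

/-- Exchanging the outside agent with the agent in position `k` is an involution on pairs of an
agent and an ordering of the others. -/
theorem sum_insert_take_eq_sum_take_succ {α : Type*} [Fintype α] [DecidableEq α]
    (v : Finset α → ℝ) {k : ℕ} (hk : k + 1 < Fintype.card α) :
    ∑ i : α, ∑ l ∈ permsOf (univ.erase i), v (insert i (l.take k).toFinset) =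
      ∑ i : α, ∑ l ∈ permsOf (univ.erase i), v (l.take (k + 1)).toFinset := by
  have hlen {i : α} {l : List α} (hl : l ∈ permsOf (univ.erase i)) : k < l.length := by
    have := length_add_one_of_mem_permsOf_erase hl
    omega
  let swap (p : (_ : α) × List α) : (_ : α) × List α := ⟨p.2.getD k p.1, p.2.set k p.1⟩
  have hmem (p) (hp : p ∈ univ.sigma fun i : α => permsOf (univ.erase i)) :
      swap p ∈ univ.sigma fun i : α => permsOf (univ.erase i) := by
    obtain ⟨i, l⟩ := p
    simp only [mem_sigma, mem_univ, true_and] at hp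
    simp only [swap, mem_sigma, mem_univ, true_and, List.getD_eq_getElem _ _ (hlen hp)]
    exact mem_permsOf_erase_iff.2
      ((List.getElem_cons_set_perm (hlen hp) i).trans (mem_permsOf_erase_iff.1 hp))
  have hswap (p) (hp : p ∈ univ.sigma fun i : α => permsOf (univ.erase i)) :
      swap (swap p) = p := by
    obtain ⟨i, l⟩ := p
    simp only [mem_sigma, mem_univ, true_and] at hp
    have := hlen hp
    simp [swap, this]
  rw [sum_sigma', sum_sigma']
  refine sum_nbij' swap swap hmem hmem hswap hswap fun p hp => ?_
  simp only [mem_sigma, mem_univ, true_and] at hp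
  simp only [swap, List.toFinset_take_succ_set (hlen hp)]

/-- The Exchange Values of all agents sum to zero: `∑_{i ∈ N} EV_i(G) = 0`. -/
theorem sum_exchangeValue_eq_zero
    {α : Type*} [Fintype α] [DecidableEq α]
    (hn : 2 ≤ Fintype.card α) (v : Finset α → ℝ) (hv : v ∅ = 0) :
    ∑ i : α, ExchangeValue v i = 0 := by
  simp only [ExchangeValue]
  rw [← mul_sum]
  simp_rw [sum_comm (t := Icc 1 (Fintype.card α - 1))]
  rw [sum_eq_zero, mul_zero]
  intro m hm
  obtain ⟨hm₁, hm₂⟩ := mem_Icc.1 hm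
  obtain ⟨k, rfl⟩ := Nat.exists_eq_add_of_le' hm₁
  simp only [sum_sub_distrib, Nat.add_sub_cancel]
  rw [sum_insert_take_eq_sum_take_succ v (by omega), sub_self]
end
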